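/- Let X, Y¹, Y² be standard Borel spaces, ζ a Borel probability measure on X, and P any information structure on X × Y¹ × Y² (no absolute-continuity assumption is imposed). Let U¹ and U² be nonempty compact metric spaces (with their Borel σ-algebras) and let c : X × U¹ × U² → ℝ be a bounded jointly measurable cost function such that (u¹,u²) ↦ c(x,u¹,u²) is continuous for every x ∈ X. Then a saddle-point equilibrium exists in randomized policies: there are Markov kernels γ¹* from Y¹ to U¹ and γ²* from Y² to U² such that J_P(γ¹*, γ²) ≤ J_P(γ¹*, γ²*) ≤ J_P(γ¹, γ²*) for all Markov kernels γ¹ from Y¹ to U¹ and γ² from Y² to U², so the zero-sum game has a value. -/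

import Mathlib

open MeasureTheory ProbabilityTheory

section Auxiliary

open Set BoundedContinuousFunction

/-- If the payoff profiles of the first player form a compact convex set, those of the second
player form a convex set, and the first player has a reply of cost at most `v` to each strategy of
the second one, then some strategy guarantees a cost at most `v`. -/
theorem exists_forall_le_of_forall_exists_le {A B : Type*} [Nonempty A] (f : A → B → ℝ)
    (hA : IsCompact (range f)) (hA' : Convex ℝ (range f))
    (hB' : Convex ℝ (range (Function.swap f))) {v : ℝ} (hv : ∀ b, ∃ a, f a b ≤ v) :
    ∃ a, ∀ b, f a b ≤ v := by
  have hfin (t : Finset B) : (range f ∩ ⋂ b ∈ t, {φ : B → ℝ | φ b ≤ v}).Nonempty := by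
    rcases t.eq_empty_or_nonempty with rfl | ⟨b₀, hb₀⟩
    · exact ⟨f (Classical.arbitrary A), by simp⟩
    let r : (B → ℝ) →L[ℝ] (t → ℝ) := ContinuousLinearMap.pi fun i ↦ ContinuousLinearMap.proj i.1
    have hX : IsCompact (r '' range f) := hA.image r.continuous
    have hX' : Convex ℝ (r '' range f) := hA'.linear_image r.toLinearMap
    classical
    obtain ⟨x, ⟨_, ⟨a, rfl⟩, rfl⟩, w, hw, hs⟩ :=
      Sion.exists_isSaddlePointOn (X := r '' range f) (Y := stdSimplex ℝ t)
        (f := fun x w ↦ ∑ i, w i * x i) ⟨_, mem_image_of_mem r (mem_range_self (Classical.arbitrary A))⟩ hX' hX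
        (fun w _ ↦ (Continuous.lowerSemicontinuous (by fun_prop)).lowerSemicontinuousOn _)
        (fun w _ ↦ by
          refine ConvexOn.quasiconvexOn ⟨hX', fun x _ y _ a b _ _ _ ↦ le_of_eq ?_⟩
          simp only [Pi.add_apply, Pi.smul_apply, smul_eq_mul, Finset.mul_sum,
            ← Finset.sum_add_distrib]
          exact Finset.sum_congr rfl fun i _ ↦ by ring)
        (convex_stdSimplex ℝ t) ⟨_, single_mem_stdSimplex ℝ (⟨b₀, hb₀⟩ : t)⟩
        (isCompact_stdSimplex ℝ t)
        (fun x _ ↦ (Continuous.upperSemicontinuous (by fun_prop)).upperSemicontinuousOn _)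
        (fun x _ ↦ by
          refine ConcaveOn.quasiconcaveOn
            ⟨convex_stdSimplex ℝ t, fun y _ z _ a b _ _ _ ↦ le_of_eq ?_⟩
          simp only [Pi.add_apply, Pi.smul_apply, smul_eq_mul, Finset.mul_sum,
            ← Finset.sum_add_distrib]
          exact Finset.sum_congr rfl fun i _ ↦ by ring)
    obtain ⟨b, hb⟩ : ∑ i, w i • Function.swap f i.1 ∈ range (Function.swap f) :=
      hB'.sum_mem (fun i _ ↦ hw.1 i) hw.2 fun i _ ↦ mem_range_self _
    obtain ⟨a', ha'⟩ := hv b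
    refine ⟨f a, mem_range_self a, mem_iInter₂.2 fun i hi ↦ ?_⟩
    have h1 := hs (r (f a')) (mem_image_of_mem r (mem_range_self a')) _
      (single_mem_stdSimplex ℝ (⟨i, hi⟩ : t))
    have h2 := congrFun hb a'
    simp only [Function.swap, Finset.sum_apply, Pi.smul_apply, smul_eq_mul] at h2
    simp [r, Pi.single_apply] at h1
    rw [Finset.sum_coe_sort_eq_attach] at h2
    simp only [mem_ofPred_eq]
    linarith
  obtain ⟨_, ⟨a, rfl⟩, ha⟩ := hA.inter_iInter_nonempty (fun b ↦ {φ : B → ℝ | φ b ≤ v})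
    (fun b ↦ isClosed_le (continuous_apply b) continuous_const) hfin
  exact ⟨a, fun b ↦ mem_iInter.1 ha b⟩

/-- Minimax theorem for a two-player game whose payoff profiles form compact convex sets for the
topology of pointwise convergence. -/
theorem exists_saddlePoint_of_isCompact_range {A B : Type*} [Nonempty A] [Nonempty B]
    (f : A → B → ℝ) (hA : IsCompact (range f)) (hA' : Convex ℝ (range f))
    (hB : IsCompact (range (Function.swap f))) (hB' : Convex ℝ (range (Function.swap f))) :
    ∃ a b, (∀ b', f a b' ≤ f a b) ∧ ∀ a', f a b ≤ f a' b := by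
  have hmin (b : B) : ∃ a, ∀ a', f a b ≤ f a' b := by
    obtain ⟨_, ⟨a, rfl⟩, ha⟩ := hA.exists_isMinOn (range_nonempty f)
      (continuous_apply b).continuousOn
    exact ⟨a, fun a' ↦ ha (mem_range_self a')⟩
  have hmax (a : A) : ∃ b, ∀ b', f a b' ≤ f a b := by
    obtain ⟨_, ⟨b, rfl⟩, hb⟩ := hB.exists_isMaxOn (range_nonempty _)
      (continuous_apply a).continuousOn
    exact ⟨b, fun b' ↦ hb (mem_range_self b')⟩
  choose m hm using hmin
  choose M hM using hmax
  have hbdd : BddAbove (range fun b ↦ f (m b) b) := by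
    let a₀ := Classical.arbitrary A
    exact ⟨f a₀ (M a₀), by rintro _ ⟨b, rfl⟩; exact (hm b a₀).trans (hM a₀ b)⟩
  set v := ⨆ b, f (m b) b
  obtain ⟨a, ha⟩ := exists_forall_le_of_forall_exists_le f hA hA' hB' (v := v)
    fun b ↦ ⟨m b, le_ciSup hbdd b⟩
  have hneg : range (fun a b ↦ - f a b) = -range f := by
    rw [← image_neg_eq_neg, ← range_comp]; rfl
  have hneg' : range (fun b a ↦ - f a b) = -range (Function.swap f) := by
    rw [← image_neg_eq_neg, ← range_comp]; rfl
  obtain ⟨b, hb⟩ := exists_forall_le_of_forall_exists_le (fun b a ↦ - f a b)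
    (hneg' ▸ hB.neg)
    (hneg' ▸ hB'.neg)
    (hneg ▸ hA'.neg) (v := -v)
    fun a ↦ ⟨M a, neg_le_neg (ciSup_le fun b ↦ (hm b a).trans (hM a b))⟩
  have hab : f a b = v := le_antisymm (ha b) (neg_le_neg_iff.1 (hb a))
  exact ⟨a, b, fun b' ↦ hab ▸ ha b', fun a' ↦ hab ▸ neg_le_neg_iff.1 (hb a')⟩

/-- A map into the continuous functions on a compact metric space is strongly measurable as soon as
its evaluations are measurable. -/
theorem stronglyMeasurable_of_forall_measurable_eval {Y U : Type*} [MeasurableSpace Y]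
    [MetricSpace U] [CompactSpace U] [Nonempty U] {G : Y → C(U, ℝ)}
    (hG : ∀ u, Measurable fun y ↦ G y u) : StronglyMeasurable G := by
  let : MeasurableSpace C(U, ℝ) := borel _
  have : BorelSpace C(U, ℝ) := ⟨rfl⟩
  let e : C(U, ℝ) → ℕ → ℝ := fun h n ↦ h (TopologicalSpace.denseSeq U n)
  have he : Continuous e := by fun_prop
  have hinj : Function.Injective e := fun h k hk ↦ DFunLike.coe_injective <|
    (TopologicalSpace.denseRange_denseSeq U).equalizer h.continuous k.continuous hk
  exact ((he.measurableEmbedding hinj).measurable_comp_iff.1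
    (measurable_pi_lambda _ fun n ↦ hG _)).stronglyMeasurable

/-- Integration of a bounded Carathéodory function is continuous on the probability measures with a
given first marginal. -/
theorem continuousOn_integral_of_fst_eq {Y U : Type*} [MeasurableSpace Y] [TopologicalSpace Y]
    [PolishSpace Y] [BorelSpace Y] [MetricSpace U] [CompactSpace U] [Nonempty U]
    [MeasurableSpace U] [BorelSpace U] (ν : Measure Y) [IsProbabilityMeasure ν] (g : Y → U → ℝ)
    (hm : Measurable fun p : Y × U ↦ g p.1 p.2) (hc : ∀ y, Continuous (g y))
    (hb : ∃ M, ∀ y u, |g y u| ≤ M) :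
    ContinuousOn (fun ρ : ProbabilityMeasure (Y × U) ↦ ∫ p, g p.1 p.2 ∂(ρ : Measure (Y × U)))
      {ρ | (ρ : Measure (Y × U)).fst = ν} := by
  let := TopologicalSpace.upgradeIsCompletelyMetrizable Y
  obtain ⟨M, hM⟩ := hb
  let G : Y → C(U, ℝ) := fun y ↦ ⟨g y, hc y⟩
  have hG : StronglyMeasurable G := stronglyMeasurable_of_forall_measurable_eval
    fun u ↦ hm.comp (measurable_id.prodMk measurable_const)
  have hGi : Integrable G ν := by
    refine Integrable.of_bound hG.aestronglyMeasurable M (ae_of_all _ fun y ↦ ?_)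
    exact (ContinuousMap.norm_le_of_nonempty _).2 fun u ↦ hM y u
  refine continuousOn_of_uniform_approx_of_continuousOn fun V hV ↦ ?_
  obtain ⟨ε, hε, hεV⟩ := Metric.mem_uniformity_dist.1 hV
  obtain ⟨h, hh, hhi⟩ := hGi.exists_boundedContinuous_integral_sub_le (half_pos hε)
  let H : (Y × U) →ᵇ ℝ := BoundedContinuousFunction.ofNormedAddCommGroup
    (fun p ↦ h p.1 p.2) (by fun_prop) ‖h‖
    fun p ↦ ((h p.1).norm_coe_le_norm p.2).trans (h.norm_coe_le_norm p.1)
  refine ⟨fun ρ ↦ ∫ p, H p ∂(ρ : Measure (Y × U)),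
    (ProbabilityMeasure.continuous_integral_boundedContinuousFunction H).continuousOn,
    fun ρ hρ ↦ hεV ?_⟩
  have hρ' : (ρ : Measure (Y × U)).map Prod.fst = ν := hρ
  have hgi : Integrable (fun p : Y × U ↦ g p.1 p.2) (ρ : Measure (Y × U)) :=
    Integrable.of_bound hm.aestronglyMeasurable M (ae_of_all _ fun p ↦ hM p.1 p.2)
  have hHi : Integrable H (ρ : Measure (Y × U)) := H.integrable _
  have hdi : Integrable (fun y ↦ ‖G y - h y‖) ν := (hGi.sub hhi).norm
  rw [← hρ'] at hdi hh
  rw [Real.dist_eq, ← integral_sub hgi hHi]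
  calc |∫ p, (g p.1 p.2 - H p) ∂(ρ : Measure (Y × U))|
      ≤ ∫ p, |g p.1 p.2 - H p| ∂(ρ : Measure (Y × U)) := abs_integral_le_integral_abs
    _ ≤ ∫ p, ‖G p.1 - h p.1‖ ∂(ρ : Measure (Y × U)) :=
        integral_mono (hgi.sub hHi).abs (hdi.comp_measurable measurable_fst)
          fun p ↦ (G p.1 - h p.1).norm_coe_le_norm p.2
    _ = ∫ y, ‖G y - h y‖ ∂((ρ : Measure (Y × U)).map Prod.fst) :=
        (integral_map measurable_fst.aemeasurable hdi.aestronglyMeasurable).symm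
    _ ≤ ε / 2 := hh
    _ < ε := half_lt_self hε

/-- The probability measures on a product with compact second factor and given first marginal form a
compact set. -/
theorem isCompact_setOf_fst_eq {Y U : Type*} [MeasurableSpace Y] [TopologicalSpace Y]
    [PolishSpace Y] [BorelSpace Y] [MetricSpace U] [CompactSpace U]
    [MeasurableSpace U] [BorelSpace U] (ν : Measure Y) [IsProbabilityMeasure ν] :
    IsCompact {ρ : ProbabilityMeasure (Y × U) | (ρ : Measure (Y × U)).fst = ν} := by
  let := TopologicalSpace.upgradeIsCompletelyMetrizable Y
  have hclosed : IsClosed {ρ : ProbabilityMeasure (Y × U) | (ρ : Measure (Y × U)).fst = ν} := by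
    let ν' : ProbabilityMeasure Y := ⟨ν, inferInstance⟩
    have h : IsClosed {ρ : ProbabilityMeasure (Y × U) |
        ρ.map (f := Prod.fst) measurable_fst.aemeasurable = ν'} :=
      isClosed_eq (ProbabilityMeasure.continuous_map continuous_fst) continuous_const
    convert h using 3 with ρ
    exact ProbabilityMeasure.toMeasure_injective.eq_iff
      (a := ρ.map (f := Prod.fst) measurable_fst.aemeasurable) (b := ν')
  rw [← hclosed.closure_eq]
  refine isCompact_closure_of_isTightMeasureSet (IsTightMeasureSet.prodMk ?_ .of_compactSpace)
  refine (isTightMeasureSet_singleton (μ := ν)).subset ?_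
  rintro _ ⟨_, ⟨ρ, hρ, rfl⟩, rfl⟩
  exact hρ

/-- The payoff profiles of the randomized policies against a family of bounded Carathéodory
functions form a compact convex set. -/
theorem isCompact_convex_range_integral_kernel {Y U ι : Type*} [MeasurableSpace Y]
    [StandardBorelSpace Y] [MetricSpace U] [CompactSpace U] [Nonempty U]
    [MeasurableSpace U] [BorelSpace U] (ν : Measure Y) [IsProbabilityMeasure ν]
    (g : ι → Y → U → ℝ) (hm : ∀ i, Measurable fun p : Y × U ↦ g i p.1 p.2)
    (hc : ∀ i y, Continuous (g i y)) (hb : ∀ i, ∃ M, ∀ y u, |g i y u| ≤ M) :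
    IsCompact (range fun (κ : {κ : Kernel Y U // IsMarkovKernel κ}) (i : ι) ↦
        ∫ y, ∫ u, g i y u ∂κ.1 y ∂ν) ∧
      Convex ℝ (range fun (κ : {κ : Kernel Y U // IsMarkovKernel κ}) (i : ι) ↦
        ∫ y, ∫ u, g i y u ∂κ.1 y ∂ν) := by
  let := upgradeStandardBorel Y
  have hint (i : ι) (ρ : Measure (Y × U)) [IsFiniteMeasure ρ] :
      Integrable (fun p : Y × U ↦ g i p.1 p.2) ρ := by
    obtain ⟨M, hM⟩ := hb i
    exact Integrable.of_bound (hm i).aestronglyMeasurable M (ae_of_all _ fun p ↦ hM p.1 p.2)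
  have himage : (range fun (κ : {κ : Kernel Y U // IsMarkovKernel κ}) (i : ι) ↦
        ∫ y, ∫ u, g i y u ∂κ.1 y ∂ν) =
      (fun (ρ : ProbabilityMeasure (Y × U)) i ↦ ∫ p, g i p.1 p.2 ∂(ρ : Measure (Y × U))) ''
        {ρ | (ρ : Measure (Y × U)).fst = ν} := by
    apply Subset.antisymm
    · rintro _ ⟨⟨κ, hκ⟩, rfl⟩
      refine ⟨⟨ν ⊗ₘ κ, inferInstance⟩, Measure.fst_compProd ν κ, ?_⟩
      ext i
      exact Measure.integral_compProd (hint i _)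
    · rintro _ ⟨ρ, hρ, rfl⟩
      refine ⟨⟨(ρ : Measure (Y × U)).condKernel, inferInstance⟩, ?_⟩
      ext i
      have hρ' : (ρ : Measure (Y × U)).fst = ν := hρ
      have hd := (ρ : Measure (Y × U)).disintegrate (ρ : Measure (Y × U)).condKernel
      have h := Measure.integral_compProd (hd.symm ▸ hint i (ρ : Measure (Y × U)))
      rw [hd, hρ'] at h
      exact h.symm
  rw [himage]
  refine ⟨(isCompact_setOf_fst_eq ν).image_of_continuousOn (continuousOn_pi.2 fun i ↦
    continuousOn_integral_of_fst_eq ν (g i) (hm i) (hc i) (hb i)), ?_⟩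
  rintro _ ⟨ρ, hρ, rfl⟩ _ ⟨σ, hσ, rfl⟩ a b ha hb hab
  have hρ' : (ρ : Measure (Y × U)).fst = ν := hρ
  have hσ' : (σ : Measure (Y × U)).fst = ν := hσ
  let τ : Measure (Y × U) := ENNReal.ofReal a • (ρ : Measure (Y × U)) +
    ENNReal.ofReal b • (σ : Measure (Y × U))
  have hab' : ENNReal.ofReal a + ENNReal.ofReal b = 1 := by
    rw [← ENNReal.ofReal_add ha hb, hab, ENNReal.ofReal_one]
  have hτ : IsProbabilityMeasure τ := ⟨by simp [τ, hab']⟩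
  refine ⟨⟨τ, hτ⟩, ?_, ?_⟩
  · change τ.fst = ν
    simp only [τ, Measure.fst] at hρ' hσ' ⊢
    rw [Measure.map_add _ _ measurable_fst, Measure.map_smul, Measure.map_smul, hρ', hσ',
      ← add_smul, hab', one_smul]
  · ext i
    change ∫ p, g i p.1 p.2 ∂τ = _
    rw [integral_add_measure ((hint i _).smul_measure ENNReal.ofReal_ne_top)
      ((hint i _).smul_measure ENNReal.ofReal_ne_top), integral_smul_measure,
      integral_smul_measure, ENNReal.toReal_ofReal ha, ENNReal.toReal_ofReal hb]
    rfl

/-- Integrating a jointly measurable function against a kernel evaluated along a measurable map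
gives a measurable function. -/
theorem measurable_integral_kernel_comp {A B U : Type*} [MeasurableSpace A] [MeasurableSpace B]
    [MeasurableSpace U] (κ : Kernel B U) [IsSFiniteKernel κ] {φ : A → B} (hφ : Measurable φ)
    {f : A → U → ℝ} (hf : Measurable fun p : A × U ↦ f p.1 p.2) :
    Measurable fun a ↦ ∫ u, f a u ∂κ (φ a) :=
  (hf.stronglyMeasurable.integral_kernel_prod_right' (κ := κ.comap φ hφ)).measurable

/-- The expected cost of a pair of randomized policies. -/
noncomputable def expectedCost {X Y₁ Y₂ U₁ U₂ : Type*} [MeasurableSpace X] [MeasurableSpace Y₁]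
    [MeasurableSpace Y₂] [MeasurableSpace U₁] [MeasurableSpace U₂] (P : Measure (X × Y₁ × Y₂))
    (c : X → U₁ → U₂ → ℝ) (γ₁ : Kernel Y₁ U₁) (γ₂ : Kernel Y₂ U₂) : ℝ :=
  ∫ p : X × Y₁ × Y₂, ∫ u₁, ∫ u₂, c p.1 u₁ u₂ ∂(γ₂ p.2.2) ∂(γ₁ p.2.1) ∂P

theorem abs_integral_le_of_forall_abs_le {A : Type*} [MeasurableSpace A] (μ : Measure A)
    [IsProbabilityMeasure μ] {f : A → ℝ} {M : ℝ} (hf : ∀ a, |f a| ≤ M) : |∫ a, f a ∂μ| ≤ M := by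
  simpa using norm_integral_le_of_norm_le_const (f := f) (μ := μ) (ae_of_all _ hf)

theorem expectedCost_swap {X Y₁ Y₂ U₁ U₂ : Type*} [MeasurableSpace X] [MeasurableSpace Y₁]
    [MeasurableSpace Y₂] [MeasurableSpace U₁] [MeasurableSpace U₂]
    (P : Measure (X × Y₁ × Y₂)) {c : X → U₁ → U₂ → ℝ} {M : ℝ}
    (hM : ∀ x u₁ u₂, |c x u₁ u₂| ≤ M)
    (hmeas : Measurable fun p : X × U₁ × U₂ ↦ c p.1 p.2.1 p.2.2)
    (γ₁ : Kernel Y₁ U₁) [IsMarkovKernel γ₁] (γ₂ : Kernel Y₂ U₂)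
    [IsMarkovKernel γ₂] :
    expectedCost (P.map fun p ↦ (p.1, p.2.2, p.2.1)) (fun x u₂ u₁ ↦ c x u₁ u₂) γ₂ γ₁ =
      expectedCost P c γ₁ γ₂ := by
  have hmeas' : Measurable fun p : (X × Y₂ × Y₁) ↦
      ∫ u₂, ∫ u₁, c p.1 u₁ u₂ ∂(γ₁ p.2.2) ∂(γ₂ p.2.1) := by
    refine measurable_integral_kernel_comp γ₂ (by fun_prop)
      (measurable_integral_kernel_comp γ₁ (by fun_prop) ?_)
    exact hmeas.comp (g := fun p : X × U₁ × U₂ ↦ c p.1 p.2.1 p.2.2)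
      (f := fun q : ((X × Y₂ × Y₁) × U₂) × U₁ ↦ (q.1.1.1, q.2, q.1.2)) (by fun_prop)
  unfold expectedCost
  rw [integral_map (by fun_prop) hmeas'.aestronglyMeasurable]
  refine integral_congr_ae (ae_of_all _ fun p ↦ integral_integral_swap ?_)
  refine Integrable.of_bound (Measurable.aestronglyMeasurable ?_) M (ae_of_all _ fun q ↦ hM _ _ _)
  exact hmeas.comp (g := fun p : X × U₁ × U₂ ↦ c p.1 p.2.1 p.2.2)
    (f := fun q : U₂ × U₁ ↦ (p.1, q.2, q.1)) (by fun_prop)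

/-- The expected cost profiles of the randomized policies of the first player form a compact
convex set. -/
theorem isCompact_convex_range_expectedCost {X Y₁ Y₂ U₁ U₂ : Type*} [MeasurableSpace X] [StandardBorelSpace X]
    [MeasurableSpace Y₁] [StandardBorelSpace Y₁] [MeasurableSpace Y₂] [StandardBorelSpace Y₂]
    [MetricSpace U₁] [CompactSpace U₁] [Nonempty U₁] [MeasurableSpace U₁] [BorelSpace U₁]
    [MeasurableSpace U₂]
    (P : Measure (X × Y₁ × Y₂)) [IsProbabilityMeasure P] {c : X → U₁ → U₂ → ℝ} {M : ℝ}
    (hM : ∀ x u₁ u₂, |c x u₁ u₂| ≤ M)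
    (hmeas : Measurable fun p : X × U₁ × U₂ ↦ c p.1 p.2.1 p.2.2)
    (hcont : ∀ x u₂, Continuous fun u₁ ↦ c x u₁ u₂) :
    IsCompact (range fun (γ₁ : {κ : Kernel Y₁ U₁ // IsMarkovKernel κ})
        (γ₂ : {κ : Kernel Y₂ U₂ // IsMarkovKernel κ}) ↦ expectedCost P c γ₁.1 γ₂.1) ∧
      Convex ℝ (range fun (γ₁ : {κ : Kernel Y₁ U₁ // IsMarkovKernel κ})
        (γ₂ : {κ : Kernel Y₂ U₂ // IsMarkovKernel κ}) ↦ expectedCost P c γ₁.1 γ₂.1) := by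
  obtain ⟨x₀, -, y₀⟩ : Nonempty (X × Y₁ × Y₂) := nonempty_of_isProbabilityMeasure P
  have : Nonempty (X × Y₂) := ⟨x₀, y₀⟩
  let Q : Measure (Y₁ × X × Y₂) := P.map fun p ↦ (p.2.1, p.1, p.2.2)
  have : IsProbabilityMeasure Q := Measure.isProbabilityMeasure_map (by fun_prop)
  let k : {κ : Kernel Y₂ U₂ // IsMarkovKernel κ} → X × Y₂ → U₁ → ℝ :=
    fun γ₂ w u₁ ↦ ∫ u₂, c w.1 u₁ u₂ ∂(γ₂.1 w.2)
  have hkm (γ₂) : Measurable fun p : (X × Y₂) × U₁ ↦ k γ₂ p.1 p.2 := by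
    have := γ₂.2
    refine measurable_integral_kernel_comp γ₂.1 (by fun_prop) ?_
    exact hmeas.comp (g := fun p : X × U₁ × U₂ ↦ c p.1 p.2.1 p.2.2)
      (f := fun q : ((X × Y₂) × U₁) × U₂ ↦ (q.1.1.1, q.1.2, q.2)) (by fun_prop)
  have hkb (γ₂ w u₁) : |k γ₂ w u₁| ≤ M := by
    have := γ₂.2
    exact abs_integral_le_of_forall_abs_le _ fun u₂ ↦ hM _ _ _
  have hkc (γ₂ w) : Continuous (k γ₂ w) := by
    have := γ₂.2
    refine continuous_of_dominated (bound := fun _ ↦ M) (fun u₁ ↦ ?_)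
      (fun u₁ ↦ ae_of_all _ fun u₂ ↦ hM _ _ _) (integrable_const M)
      (ae_of_all _ fun u₂ ↦ hcont _ _)
    refine Measurable.aestronglyMeasurable ?_
    exact hmeas.comp (g := fun p : X × U₁ × U₂ ↦ c p.1 p.2.1 p.2.2)
      (f := fun u₂ ↦ (w.1, u₁, u₂)) (by fun_prop)
  have hmain := isCompact_convex_range_integral_kernel Q.fst
    (fun γ₂ y₁ u₁ ↦ ∫ w, k γ₂ w u₁ ∂(Q.condKernel y₁))
    (fun γ₂ ↦ measurable_integral_kernel_comp Q.condKernel measurable_fst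
      ((hkm γ₂).comp (g := fun p : (X × Y₂) × U₁ ↦ k γ₂ p.1 p.2)
        (f := fun q : (Y₁ × U₁) × X × Y₂ ↦ (q.2, q.1.2)) (by fun_prop)))
    (fun γ₂ y₁ ↦ continuous_of_dominated (bound := fun _ ↦ M)
      (fun u₁ ↦ ((hkm γ₂).comp (measurable_id.prodMk measurable_const)).aestronglyMeasurable)
      (fun u₁ ↦ ae_of_all _ fun w ↦ hkb γ₂ w u₁) (integrable_const M)
      (ae_of_all _ fun w ↦ hkc γ₂ w))
    (fun γ₂ ↦ ⟨M, fun y₁ u₁ ↦ abs_integral_le_of_forall_abs_le _ fun w ↦ hkb γ₂ w u₁⟩)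
  have heq (γ₁ : {κ : Kernel Y₁ U₁ // IsMarkovKernel κ})
      (γ₂ : {κ : Kernel Y₂ U₂ // IsMarkovKernel κ}) : expectedCost P c γ₁.1 γ₂.1 =
        ∫ y₁, ∫ u₁, ∫ w, k γ₂ w u₁ ∂(Q.condKernel y₁) ∂(γ₁.1 y₁) ∂Q.fst := by
    have := γ₁.2
    have hm : Measurable fun q : Y₁ × X × Y₂ ↦ ∫ u₁, k γ₂ q.2 u₁ ∂(γ₁.1 q.1) :=
      measurable_integral_kernel_comp γ₁.1 measurable_fst
        ((hkm γ₂).comp (g := fun p : (X × Y₂) × U₁ ↦ k γ₂ p.1 p.2)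
          (f := fun q : (Y₁ × X × Y₂) × U₁ ↦ (q.1.2, q.2)) (by fun_prop))
    have hi : Integrable (fun q : Y₁ × X × Y₂ ↦ ∫ u₁, k γ₂ q.2 u₁ ∂(γ₁.1 q.1)) Q :=
      Integrable.of_bound hm.aestronglyMeasurable M
        (ae_of_all _ fun q ↦ abs_integral_le_of_forall_abs_le _ fun u₁ ↦ hkb γ₂ q.2 u₁)
    have hd := Q.disintegrate Q.condKernel
    calc expectedCost P c γ₁.1 γ₂.1
        = ∫ q, ∫ u₁, k γ₂ q.2 u₁ ∂(γ₁.1 q.1) ∂Q :=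
          (integral_map (φ := fun p : X × Y₁ × Y₂ ↦ (p.2.1, p.1, p.2.2)) (by fun_prop)
            hm.aestronglyMeasurable).symm
      _ = ∫ y₁, ∫ w, ∫ u₁, k γ₂ w u₁ ∂(γ₁.1 y₁) ∂(Q.condKernel y₁) ∂Q.fst := by
          conv_lhs => rw [← hd]
          exact Measure.integral_compProd (hd.symm ▸ hi)
      _ = _ := by
          refine integral_congr_ae (ae_of_all _ fun y₁ ↦ integral_integral_swap ?_)
          exact Integrable.of_bound (hkm γ₂).aestronglyMeasurable M
            (ae_of_all _ fun q ↦ hkb γ₂ q.1 q.2)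
  simpa only [heq] using hmain

end Auxiliary

/-- Existence of a saddle-point equilibrium in randomized policies for a
zero-sum Bayesian game with standard Borel spaces, compact metric action spaces and a bounded
measurable cost continuous in the actions; no absolute-continuity assumption is imposed on
the information structure. Consequently the game has a value. -/
theorem existence_of_equilibrium_relaxed
    {X Y₁ Y₂ : Type*} [MeasurableSpace X] [StandardBorelSpace X]
    [MeasurableSpace Y₁] [StandardBorelSpace Y₁]
    [MeasurableSpace Y₂] [StandardBorelSpace Y₂]
    (ζ : Measure X) [IsProbabilityMeasure ζ]
    (P : Measure (X × Y₁ × Y₂)) [IsProbabilityMeasure P]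
    (hmarg : P.map Prod.fst = ζ)
    {U₁ U₂ : Type*} [MetricSpace U₁] [CompactSpace U₁] [Nonempty U₁]
    [MeasurableSpace U₁] [BorelSpace U₁]
    [MetricSpace U₂] [CompactSpace U₂] [Nonempty U₂]
    [MeasurableSpace U₂] [BorelSpace U₂]
    (c : X → U₁ → U₂ → ℝ)
    (hbdd : ∃ M : ℝ, ∀ x u₁ u₂, |c x u₁ u₂| ≤ M)
    (hmeas : Measurable fun p : X × U₁ × U₂ => c p.1 p.2.1 p.2.2)
    (hcont : ∀ x, Continuous fun q : U₁ × U₂ => c x q.1 q.2)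
    (J : Kernel Y₁ U₁ → Kernel Y₂ U₂ → ℝ)
    (hJ : ∀ γ₁ γ₂, J γ₁ γ₂ =
      ∫ p : X × Y₁ × Y₂, ∫ u₁, ∫ u₂, c p.1 u₁ u₂ ∂(γ₂ p.2.2) ∂(γ₁ p.2.1) ∂P) :
    ∃ (γ₁s : Kernel Y₁ U₁) (γ₂s : Kernel Y₂ U₂),
      IsMarkovKernel γ₁s ∧ IsMarkovKernel γ₂s ∧
      (∀ γ₂ : Kernel Y₂ U₂, IsMarkovKernel γ₂ → J γ₁s γ₂ ≤ J γ₁s γ₂s) ∧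
      (∀ γ₁ : Kernel Y₁ U₁, IsMarkovKernel γ₁ → J γ₁s γ₂s ≤ J γ₁ γ₂s) ∧
      (⨅ γ₁ : {κ : Kernel Y₁ U₁ // IsMarkovKernel κ},
          ⨆ γ₂ : {κ : Kernel Y₂ U₂ // IsMarkovKernel κ}, J γ₁.1 γ₂.1) =
        (⨆ γ₂ : {κ : Kernel Y₂ U₂ // IsMarkovKernel κ},
          ⨅ γ₁ : {κ : Kernel Y₁ U₁ // IsMarkovKernel κ}, J γ₁.1 γ₂.1) := by
  obtain ⟨M, hM⟩ := hbdd
  obtain ⟨x₀, y₁, y₂⟩ : Nonempty (X × Y₁ × Y₂) := nonempty_of_isProbabilityMeasure P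
  let A := {κ : Kernel Y₁ U₁ // IsMarkovKernel κ}
  let B := {κ : Kernel Y₂ U₂ // IsMarkovKernel κ}
  have : Nonempty A := ⟨Kernel.const _ (Measure.dirac (Classical.arbitrary U₁)), inferInstance⟩
  have : Nonempty B := ⟨Kernel.const _ (Measure.dirac (Classical.arbitrary U₂)), inferInstance⟩
  have hJ' (a : A) (b : B) : J a.1 b.1 = expectedCost P c a.1 b.1 := hJ _ _
  have hJs (a : A) (b : B) : J a.1 b.1 =
      expectedCost (P.map fun p ↦ (p.1, p.2.2, p.2.1)) (fun x u₂ u₁ ↦ c x u₁ u₂) b.1 a.1 := by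
    have := a.2
    have := b.2
    rw [hJ', expectedCost_swap P hM hmeas]
  have hb (a : A) (b : B) : |J a.1 b.1| ≤ M := by
    have := a.2
    have := b.2
    rw [hJ]
    exact abs_integral_le_of_forall_abs_le _ fun p ↦ abs_integral_le_of_forall_abs_le _ fun u₁ ↦
      abs_integral_le_of_forall_abs_le _ fun u₂ ↦ hM _ _ _
  obtain ⟨h₁, h₁'⟩ := isCompact_convex_range_expectedCost (Y₁ := Y₁) (Y₂ := Y₂) P hM hmeas
    fun x u₂ ↦ (hcont x).comp (by fun_prop : Continuous fun u₁ : U₁ ↦ (u₁, u₂))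
  have : IsProbabilityMeasure (P.map fun p ↦ (p.1, p.2.2, p.2.1)) :=
    Measure.isProbabilityMeasure_map (by fun_prop)
  obtain ⟨h₂, h₂'⟩ := isCompact_convex_range_expectedCost
    (P.map fun p ↦ (p.1, p.2.2, p.2.1)) (c := fun x u₂ u₁ ↦ c x u₁ u₂)
    (fun x u₂ u₁ ↦ hM x u₁ u₂)
    (hmeas.comp (g := fun p : X × U₁ × U₂ ↦ c p.1 p.2.1 p.2.2)
      (f := fun q : X × U₂ × U₁ ↦ (q.1, q.2.2, q.2.1)) (by fun_prop))
    fun x u₁ ↦ (hcont x).comp (by fun_prop : Continuous fun u₂ : U₂ ↦ (u₁, u₂))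
  obtain ⟨a, b, hab, hab'⟩ := exists_saddlePoint_of_isCompact_range
    (fun (a : A) (b : B) ↦ J a.1 b.1) (by simpa only [hJ'] using h₁)
    (by simpa only [hJ'] using h₁') (by simpa only [Function.swap, hJs] using h₂)
    (by simpa only [Function.swap, hJs] using h₂')
  refine ⟨a.1, b.1, a.2, b.2, fun γ₂ h ↦ hab ⟨γ₂, h⟩, fun γ₁ h ↦ hab' ⟨γ₁, h⟩, ?_⟩
  have hbelow (b : B) : BddBelow (Set.range fun a : A ↦ J a.1 b.1) :=
    ⟨-M, by rintro _ ⟨a, rfl⟩; exact (abs_le.1 (hb a b)).1⟩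
  have habove (a : A) : BddAbove (Set.range fun b : B ↦ J a.1 b.1) :=
    ⟨M, by rintro _ ⟨b, rfl⟩; exact (abs_le.1 (hb a b)).2⟩
  apply le_antisymm
  · calc (⨅ a : A, ⨆ b : B, J a.1 b.1)
        ≤ ⨆ b' : B, J a.1 b'.1 :=
          ciInf_le ⟨-M, by
            rintro _ ⟨a', rfl⟩
            exact (abs_le.1 (hb a' b)).1.trans (le_ciSup (habove a') b)⟩ a
      _ ≤ J a.1 b.1 := ciSup_le hab
      _ ≤ ⨅ a' : A, J a'.1 b.1 := le_ciInf hab'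
      _ ≤ ⨆ b : B, ⨅ a : A, J a.1 b.1 :=
          le_ciSup (f := fun b : B ↦ ⨅ a : A, J a.1 b.1) ⟨M, by
            rintro _ ⟨b', rfl⟩
            exact (ciInf_le (hbelow b') a).trans (abs_le.1 (hb a b')).2⟩ b
  · exact ciSup_le fun b' ↦ le_ciInf fun a' ↦
      (ciInf_le (hbelow b') a').trans (le_ciSup (habove a') b')
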